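/- For an integral domain R the following conditions are equivalent: (1) R has no nonzero proper strong ideals; (2) R has no nonzero strong prime ideals; (3) R has no strongly divisorial prime ideals and every maximal ideal of R is invertible; (4) R has no strongly divisorial prime ideals and every maximal ideal of R is divisorial; (5) R is completely integrally closed and every maximal ideal of R is divisorial; (6) R is a Dedekind domain; (7) every nonzero ideal of R is invertible. -/

import Mathlib

/-! Basic notions: for an integral domain `R` with fraction field `K`, an ideal `I`
is viewed as the submodule `idealToFrac R I` of `K`; `1 / M` is the Mathlib
submodule quotient `(R : M) = {x ∈ K | x M ⊆ R}` and `M / N = {x ∈ K | x N ⊆ M}`. -/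

variable (R : Type*) [CommRing R] [IsDomain R]

/-- The image of an ideal of `R` in the fraction field, as an `R`-submodule. -/
def idealToFrac (I : Ideal R) : Submodule R (FractionRing R) :=
  Submodule.map (Algebra.linearMap R (FractionRing R)) I

/-- An ideal `I` is strong if `(R : I) = (I : I)`. -/
def IsStrong (I : Ideal R) : Prop :=
  1 / idealToFrac R I = idealToFrac R I / idealToFrac R I

/-- An ideal `I` is divisorial if `(R : (R : I)) = I`. -/
def IsDivisorial (I : Ideal R) : Prop :=
  1 / (1 / idealToFrac R I) = idealToFrac R I

/-- `R` is seminormal if every `x ∈ K` with `x², x³ ∈ R` lies in `R`. -/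
def Seminormal : Prop :=
  ∀ x : FractionRing R,
    x ^ 2 ∈ (algebraMap R (FractionRing R)).range →
    x ^ 3 ∈ (algebraMap R (FractionRing R)).range →
    x ∈ (algebraMap R (FractionRing R)).range

/-- `R` is completely integrally closed if every almost integral element of `K` lies in `R`. -/
def CompletelyIntegrallyClosed : Prop :=
  ∀ x : FractionRing R,
    (∃ d : R, d ≠ 0 ∧
      ∀ n : ℕ, algebraMap R (FractionRing R) d * x ^ n ∈ (algebraMap R (FractionRing R)).range) →
    x ∈ (algebraMap R (FractionRing R)).range

/-- The `v`-operation `M ↦ (R : (R : M))` on submodules of the fraction field. -/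
def vOp (M : Submodule R (FractionRing R)) : Submodule R (FractionRing R) :=
  1 / (1 / M)

/-- The `t`-closure `M_t = ⋃ J_v`, the union over finitely generated `J ⊆ M`. -/
def tClosure (M : Submodule R (FractionRing R)) : Submodule R (FractionRing R) :=
  ⨆ (J : Submodule R (FractionRing R)) (_ : J.FG) (_ : J ≤ M), vOp R J

/-- An ideal `I` is a `t`-ideal if `I_t = I`. -/
def IsTIdeal (I : Ideal R) : Prop :=
  tClosure R (idealToFrac R I) = idealToFrac R I

/-- A maximal `t`-ideal is an ideal maximal among the proper integral `t`-ideals. -/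
def IsMaximalTIdeal (I : Ideal R) : Prop :=
  I ≠ ⊤ ∧ IsTIdeal R I ∧ ∀ J : Ideal R, J ≠ ⊤ → IsTIdeal R J → I ≤ J → J = I

/-- An ideal `I` is `t`-invertible if `(I (R : I))_t = R`. -/
def IsTInvertible (I : Ideal R) : Prop :=
  tClosure R (idealToFrac R I * (1 / idealToFrac R I)) = 1

/-- An ideal `I` is invertible if `I (R : I) = R`. -/
def IsInvertibleIdeal (I : Ideal R) : Prop :=
  idealToFrac R I * (1 / idealToFrac R I) = 1


section Helpers

set_option linter.unusedSectionVars false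

variable {R : Type*} [CommRing R] [IsDomain R]

local notation "F" => FractionRing R

lemma mem_itf {I : Ideal R} {y : F} :
    y ∈ idealToFrac R I ↔ ∃ r ∈ I, algebraMap R F r = y := by
  simp [idealToFrac, Submodule.mem_map]

lemma algebraMap_mem_itf {I : Ideal R} {r : R} :
    algebraMap R F r ∈ idealToFrac R I ↔ r ∈ I := by
  rw [mem_itf]
  constructor
  · rintro ⟨s, hs, h⟩
    rwa [← IsFractionRing.injective R F h]
  · intro h
    exact ⟨r, h, rfl⟩

lemma itf_le {I J : Ideal R} : idealToFrac R I ≤ idealToFrac R J ↔ I ≤ J := by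
  constructor
  · intro h r hr
    exact algebraMap_mem_itf.1 (h (algebraMap_mem_itf.2 hr))
  · intro h
    exact Submodule.map_mono h

lemma itf_inj {I J : Ideal R} (h : idealToFrac R I = idealToFrac R J) : I = J :=
  le_antisymm (itf_le.1 h.le) (itf_le.1 h.ge)

lemma itf_mul (I J : Ideal R) :
    idealToFrac R (I * J) = idealToFrac R I * idealToFrac R J :=
  IsLocalization.coeSubmodule_mul F I J

lemma itf_top : idealToFrac R (⊤ : Ideal R) = 1 :=
  IsLocalization.coeSubmodule_top F

lemma itf_le_one (I : Ideal R) : idealToFrac R I ≤ 1 := by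
  rw [← itf_top]; exact itf_le.2 le_top

lemma exists_itf {N : Submodule R F} (h : N ≤ 1) : ∃ J : Ideal R, idealToFrac R J = N := by
  refine ⟨N.comap (Algebra.linearMap R F), ?_⟩
  rw [idealToFrac, Submodule.map_comap_eq, ← Submodule.one_eq_range]
  exact inf_eq_right.2 h

lemma one_mem_div (I : Ideal R) : (1 : F) ∈ 1 / idealToFrac R I := by
  rw [Submodule.mem_div_iff_forall_mul_mem]
  intro y hy
  rw [one_mul]
  exact itf_le_one I hy

lemma inv_of_mul {I : Ideal R} {N : Submodule R F} (h : idealToFrac R I * N = 1) :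
    IsInvertibleIdeal R I := by
  refine le_antisymm Submodule.mul_one_div_le_one ?_
  have hN : N ≤ 1 / idealToFrac R I := by
    rw [Submodule.le_div_iff_mul_le, mul_comm, h]
  exact h.ge.trans (mul_le_mul' le_rfl hN)

lemma isInv_mul {I J : Ideal R} (hI : IsInvertibleIdeal R I) (hJ : IsInvertibleIdeal R J) :
    IsInvertibleIdeal R (I * J) := by
  unfold IsInvertibleIdeal at hI hJ
  apply inv_of_mul (N := (1 / idealToFrac R I) * (1 / idealToFrac R J))
  rw [itf_mul, mul_mul_mul_comm, hI, hJ, one_mul]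

lemma inv_top : IsInvertibleIdeal R (⊤ : Ideal R) := by
  apply inv_of_mul (N := 1)
  rw [itf_top, one_mul]

lemma isInv_pow {I : Ideal R} (hI : IsInvertibleIdeal R I) (n : ℕ) :
    IsInvertibleIdeal R (I ^ n) := by
  induction n with
  | zero => rw [pow_zero, Ideal.one_eq_top]; exact inv_top
  | succ n ih => rw [pow_succ]; exact isInv_mul ih hI

lemma inv_dvd {I M : Ideal R} (hM : IsInvertibleIdeal R M) (h : I ≤ M) :
    ∃ J : Ideal R, I = M * J := by
  unfold IsInvertibleIdeal at hM
  have : (1 / idealToFrac R M) * idealToFrac R I ≤ 1 := by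
    rw [mul_comm]
    exact (mul_le_mul' (itf_le.2 h) le_rfl).trans hM.le
  obtain ⟨J, hJ⟩ := exists_itf this
  refine ⟨J, itf_inj ?_⟩
  rw [itf_mul, hJ, ← mul_assoc, hM, one_mul]

lemma inv_cancel {I J M : Ideal R} (hM : IsInvertibleIdeal R M) (h : M * I = M * J) :
    I = J := by
  unfold IsInvertibleIdeal at hM
  apply itf_inj
  have := congrArg (fun X => (1 / idealToFrac R M) * idealToFrac R X) h
  simp only [itf_mul, ← mul_assoc] at this
  rwa [mul_comm _ (idealToFrac R M), hM, one_mul, one_mul] at this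

lemma inv_fg {I : Ideal R} (hI : IsInvertibleIdeal R I) : I.FG := by
  have hu : IsUnit (idealToFrac R I) := IsUnit.of_mul_eq_one _ hI
  exact Submodule.fg_of_fg_map_injective (Algebra.linearMap R F)
    (IsFractionRing.injective R F) (Submodule.fg_of_isUnit hu)

lemma mem_of_inv {I : Ideal R} (hI : IsInvertibleIdeal R I) {y : F}
    (h : ∀ z ∈ 1 / idealToFrac R I, y * z ∈ (1 : Submodule R F)) :
    y ∈ idealToFrac R I := by
  have key : ∀ w ∈ idealToFrac R I * (1 / idealToFrac R I), y * w ∈ idealToFrac R I := by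
    intro w hw
    induction hw using Submodule.mul_induction_on' with
    | mem_mul_mem m hm n hn =>
      obtain ⟨r, hr⟩ := Submodule.mem_one.1 (h n hn)
      have : y * (m * n) = r • m := by
        rw [Algebra.smul_def, hr]; ring
      rw [this]
      exact Submodule.smul_mem _ _ hm
    | add x _ z _ hx hz =>
      rw [mul_add]; exact add_mem hx hz
  rw [hI] at key
  simpa using key 1 (Submodule.one_le.1 le_rfl)

lemma le_vv (I : Ideal R) : idealToFrac R I ≤ 1 / (1 / idealToFrac R I) := by
  rw [Submodule.le_div_iff_mul_le]
  exact Submodule.mul_one_div_le_one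

lemma inv_divisorial {I : Ideal R} (hI : IsInvertibleIdeal R I) : IsDivisorial R I := by
  refine le_antisymm ?_ (le_vv I)
  intro y hy
  exact mem_of_inv hI (fun z hz => Submodule.mem_div_iff_forall_mul_mem.1 hy z hz)

lemma div_self_le (I : Ideal R) :
    idealToFrac R I / idealToFrac R I ≤ 1 / idealToFrac R I := by
  intro x hx
  rw [Submodule.mem_div_iff_forall_mul_mem] at hx ⊢
  exact fun y hy => itf_le_one I (hx y hy)

/-- a maximal ideal which is not strong is invertible -/
lemma inv_of_not_strong {M : Ideal R} (hM : M.IsMaximal) (h : ¬ IsStrong R M) :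
    IsInvertibleIdeal R M := by
  obtain ⟨J, hJ⟩ := exists_itf (Submodule.mul_one_div_le_one (I := idealToFrac R M))
  have hMJ : M ≤ J := by
    rw [← itf_le, hJ]
    intro x hx
    simpa using Submodule.mul_mem_mul hx (one_mem_div M)
  by_cases hJt : J = ⊤
  · rw [hJt, itf_top] at hJ
    exact hJ.symm
  · exfalso
    have := hM.eq_of_le hJt hMJ
    subst this
    apply h
    refine le_antisymm ?_ (div_self_le _)
    rw [Submodule.le_div_iff_mul_le, mul_comm]
    exact hJ.ge

lemma not_inv_strong {I : Ideal R} (h1 : I ≠ ⊤) (hs : IsStrong R I)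
    (hI : IsInvertibleIdeal R I) : False := by
  apply h1
  rw [eq_top_iff, ← itf_le, itf_top, ← hI, hs, mul_comm]
  exact Submodule.le_div_iff_mul_le.1 le_rfl

lemma exists_pow {M : Ideal R} {a : R} (h : a ∉ ⨅ n : ℕ, M ^ n) :
    ∃ n, a ∈ M ^ n ∧ a ∉ M ^ (n + 1) := by
  by_contra! hc
  apply h
  rw [Ideal.mem_iInf]
  intro n
  induction n with
  | zero => simp
  | succ n ih => exact hc n ih

lemma factor {M : Ideal R} (hI : IsInvertibleIdeal R M) {a : R} {n : ℕ}
    (h : a ∈ M ^ n) (h' : a ∉ M ^ (n + 1)) :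
    ∃ A : Ideal R, Ideal.span {a} = M ^ n * A ∧ ¬ A ≤ M := by
  obtain ⟨A, hA⟩ := inv_dvd (isInv_pow hI n) ((Ideal.span_singleton_le_iff_mem _).2 h)
  refine ⟨A, hA, fun hle => h' ?_⟩
  rw [← Ideal.span_singleton_le_iff_mem, hA, pow_succ]
  exact Ideal.mul_mono_right hle

lemma iInf_prime {M : Ideal R} (hM : M.IsMaximal) (hI : IsInvertibleIdeal R M) :
    (⨅ n : ℕ, M ^ n).IsPrime := by
  have hp := hM.isPrime
  refine ⟨?_, ?_⟩
  · intro h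
    apply hM.ne_top
    rw [eq_top_iff, ← h]
    simpa using iInf_le (fun n : ℕ => M ^ n) 1
  · intro a b hab
    by_contra! hc
    obtain ⟨n, hn, hn'⟩ := exists_pow hc.1
    obtain ⟨m, hm, hm'⟩ := exists_pow hc.2
    obtain ⟨A, hA, hAM⟩ := factor hI hn hn'
    obtain ⟨B, hB, hBM⟩ := factor hI hm hm'
    have h1 : a * b ∈ M ^ (n + m + 1) := (Ideal.mem_iInf.1 hab) _
    obtain ⟨C, hC⟩ := inv_dvd (isInv_pow hI _) ((Ideal.span_singleton_le_iff_mem _).2 h1)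
    rw [← Ideal.span_singleton_mul_span_singleton, hA, hB] at hC
    have h2 : M ^ (n + m) * (A * B) = M ^ (n + m) * (M * C) := by
      calc _ = M ^ n * A * (M ^ m * B) := by ring
        _ = _ := by rw [hC]; ring
    have h3 := inv_cancel (isInv_pow hI _) h2
    have h4 : A * B ≤ M := h3 ▸ Ideal.mul_le_left
    rcases hp.mul_le.1 h4 with h | h
    · exact hAM h
    · exact hBM h

lemma le_pow_mul {M P : Ideal R} (h : P ≤ M * P) (n : ℕ) : P ≤ M ^ n * P := by
  induction n with
  | zero => simp
  | succ n ih =>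
    calc P ≤ M ^ n * P := ih
      _ ≤ M ^ n * (M * P) := Ideal.mul_mono_right h
      _ = M ^ (n + 1) * P := by ring

lemma le_iInf_of_le_mul {M P : Ideal R} (h : P ≤ M * P) : P ≤ ⨅ n : ℕ, M ^ n :=
  le_iInf fun n => (le_pow_mul h n).trans Ideal.mul_le_left

lemma iInf_le_mul {M : Ideal R} (hI : IsInvertibleIdeal R M) :
    (⨅ n : ℕ, M ^ n) ≤ M * ⨅ n : ℕ, M ^ n := by
  have hle : (⨅ n : ℕ, M ^ n) ≤ M := by simpa using iInf_le (fun n : ℕ => M ^ n) 1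
  obtain ⟨J, hJ⟩ := inv_dvd hI hle
  have : J ≤ ⨅ n : ℕ, M ^ n := by
    refine le_iInf fun n => ?_
    obtain ⟨C, hC⟩ := inv_dvd (isInv_pow hI (n + 1)) (iInf_le (fun n : ℕ => M ^ n) (n + 1))
    rw [hJ, pow_succ', mul_assoc] at hC
    rw [inv_cancel hI hC]
    exact Ideal.mul_le_left
  conv_lhs => rw [hJ]
  exact Ideal.mul_mono_right this

lemma iInf_strong {M : Ideal R} (hI : IsInvertibleIdeal R M) :
    IsStrong R (⨅ n : ℕ, M ^ n) := by
  refine le_antisymm ?_ (div_self_le _)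
  intro x hx
  rw [Submodule.mem_div_iff_forall_mul_mem] at hx ⊢
  intro y hy
  obtain ⟨r, hr⟩ := Submodule.mem_one.1 (hx y hy)
  rw [← hr, algebraMap_mem_itf, Ideal.mem_iInf]
  intro n
  rw [← algebraMap_mem_itf, hr]
  have h1 := itf_le.2 (le_pow_mul (iInf_le_mul hI) n) hy
  rw [itf_mul] at h1
  clear hr hy
  induction h1 using Submodule.mul_induction_on' with
  | mem_mul_mem m hm q hq =>
    obtain ⟨s, hs⟩ := Submodule.mem_one.1 (hx q hq)
    have : x * (m * q) = s • m := by
      rw [Algebra.smul_def, hs]; ring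
    rw [this]
    exact Submodule.smul_mem _ _ hm
  | add a _ b _ ha hb =>
    rw [mul_add]; exact add_mem ha hb

lemma iInf_divisorial {M : Ideal R} (hI : IsInvertibleIdeal R M) :
    IsDivisorial R (⨅ n : ℕ, M ^ n) := by
  refine le_antisymm ?_ (le_vv _)
  intro y hy
  rw [Submodule.mem_div_iff_forall_mul_mem] at hy
  obtain ⟨r, hr⟩ := Submodule.mem_one.1 (hy 1 (one_mem_div _))
  rw [mul_one] at hr
  subst hr
  rw [algebraMap_mem_itf, Ideal.mem_iInf]
  intro n
  rw [← algebraMap_mem_itf]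
  refine mem_of_inv (isInv_pow hI n) fun z hz => hy z ?_
  rw [Submodule.mem_div_iff_forall_mul_mem] at hz ⊢
  exact fun w hw => hz w (itf_le.2 (iInf_le (fun n : ℕ => M ^ n) n) hw)

lemma three_to_seven
    (h1 : ¬ ∃ P : Ideal R, P.IsPrime ∧ P ≠ ⊥ ∧ IsStrong R P ∧ IsDivisorial R P)
    (h2 : ∀ M : Ideal R, M.IsMaximal → M ≠ ⊥ → IsInvertibleIdeal R M) :
    ∀ I : Ideal R, I ≠ ⊥ → IsInvertibleIdeal R I := by
  have h0 : ∀ M : Ideal R, M.IsMaximal → M ≠ ⊥ → (⨅ n : ℕ, M ^ n) = ⊥ := by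
    intro M hM hb
    by_contra hne
    have hI := h2 M hM hb
    exact h1 ⟨_, iInf_prime hM hI, hne, iInf_strong hI, iInf_divisorial hI⟩
  have hmax : ∀ P : Ideal R, P.IsPrime → P ≠ ⊥ → P.IsMaximal := by
    intro P hP hb
    obtain ⟨M, hM, hPM⟩ := Ideal.exists_le_maximal P hP.ne_top
    have hMb : M ≠ ⊥ := fun h => hb (le_bot_iff.1 (h ▸ hPM))
    by_cases hMP : M ≤ P
    · rwa [le_antisymm hPM hMP]
    · exfalso
      obtain ⟨J, hJ⟩ := inv_dvd (h2 M hM hMb) hPM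
      have hJP : J ≤ P := (hP.mul_le.1 hJ.ge).resolve_left hMP
      have : P ≤ M * P := by
        conv_lhs => rw [hJ]
        exact Ideal.mul_mono_right hJP
      exact hb (le_bot_iff.1 ((le_iInf_of_le_mul this).trans (h0 M hM hMb).le))
  have hN : IsNoetherianRing R := by
    apply IsNoetherianRing.of_prime
    intro P hP
    by_cases hb : P = ⊥
    · rw [hb]; exact Submodule.fg_bot
    · exact inv_fg (h2 P (hmax P hP hb) hb)
  intro I
  induction I using IsNoetherian.induction with
  | hgt I ih =>
    intro hb
    by_cases ht : I = ⊤
    · rw [ht]; exact inv_top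
    obtain ⟨M, hM, hIM⟩ := Ideal.exists_le_maximal I ht
    have hMb : M ≠ ⊥ := fun h => hb (le_bot_iff.1 (h ▸ hIM))
    obtain ⟨J, hJ⟩ := inv_dvd (h2 M hM hMb) hIM
    have hIJ : I ≤ J := hJ.le.trans Ideal.mul_le_right
    have hne : I ≠ J := by
      intro h
      rw [← h] at hJ
      exact hb (le_bot_iff.1 ((le_iInf_of_le_mul hJ.le).trans (h0 M hM hMb).le))
    have hJb : J ≠ ⊥ := fun h => hb (le_bot_iff.1 (h ▸ hIJ))
    rw [hJ]
    exact isInv_mul (h2 M hM hMb) (ih J (lt_of_le_of_ne hIJ hne) hJb)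

lemma seven_to_cic (h : ∀ I : Ideal R, I ≠ ⊥ → IsInvertibleIdeal R I) :
    CompletelyIntegrallyClosed R := by
  rintro x ⟨d, hd, hx⟩
  let I : Ideal R :=
    { carrier := {r | ∀ n : ℕ, algebraMap R F r * x ^ n ∈ (algebraMap R F).range}
      add_mem' := by
        intro a b ha hb n
        rw [map_add, add_mul]
        exact add_mem (ha n) (hb n)
      zero_mem' := by
        intro n
        rw [map_zero, zero_mul]
        exact zero_mem _
      smul_mem' := by
        intro c a ha n
        rw [smul_eq_mul, map_mul, mul_assoc]
        exact mul_mem ⟨c, rfl⟩ (ha n) }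
  have hIb : I ≠ ⊥ := by
    intro hb
    have hdI : d ∈ I := hx
    rw [hb] at hdI
    exact hd (by simpa using hdI)
  have hI := h I hIb
  have hxI : x ∈ idealToFrac R I / idealToFrac R I := by
    rw [Submodule.mem_div_iff_forall_mul_mem]
    intro y hy
    obtain ⟨r, hr, rfl⟩ := mem_itf.1 hy
    obtain ⟨s, hs⟩ := hr 1
    rw [pow_one] at hs
    rw [mul_comm, ← hs, algebraMap_mem_itf]
    intro n
    rw [hs, mul_assoc, ← pow_succ']
    exact hr (n + 1)
  have h1 : (idealToFrac R I / idealToFrac R I) * (idealToFrac R I * (1 / idealToFrac R I)) ≤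
      1 := by
    rw [← mul_assoc]
    exact (mul_le_mul' (Submodule.le_div_iff_mul_le.1 le_rfl) le_rfl).trans hI.le
  rw [hI, mul_one] at h1
  obtain ⟨r, hr⟩ := Submodule.mem_one.1 (h1 hxI)
  exact ⟨r, hr⟩

lemma cic_no_strong (h : CompletelyIntegrallyClosed R) :
    ¬ ∃ P : Ideal R, P.IsPrime ∧ P ≠ ⊥ ∧ IsStrong R P ∧ IsDivisorial R P := by
  rintro ⟨P, hP, hb, hs, hd⟩
  obtain ⟨d, hdP, hd0⟩ := Submodule.exists_mem_ne_zero_of_ne_bot hb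
  apply hP.ne_top
  apply itf_inj
  rw [itf_top, ← hd]
  have h1 : (1 / idealToFrac R P) = 1 := by
    refine le_antisymm ?_ (Submodule.one_le.2 (one_mem_div P))
    intro x hx
    rw [hs, Submodule.mem_div_iff_forall_mul_mem] at hx
    have hn : ∀ n : ℕ, algebraMap R F d * x ^ n ∈ idealToFrac R P := by
      intro n
      induction n with
      | zero => simpa using algebraMap_mem_itf.2 hdP
      | succ n ih =>
        have := hx _ ih
        rwa [mul_left_comm, ← pow_succ'] at this
    obtain ⟨r, hr⟩ := h x ⟨d, hd0, fun n => by
      obtain ⟨r, _, hr⟩ := mem_itf.1 (hn n)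
      exact ⟨r, hr⟩⟩
    exact Submodule.mem_one.2 ⟨r, hr⟩
  rw [h1]
  refine le_antisymm ?_ ?_
  · intro x hx
    simpa using Submodule.mem_div_iff_forall_mul_mem.1 hx 1 (Submodule.one_le.1 le_rfl)
  · rw [Submodule.le_div_iff_mul_le, one_mul]

open scoped nonZeroDivisors in
lemma inv_iff {I : Ideal R} (hb : I ≠ ⊥) :
    IsInvertibleIdeal R I ↔ (I : FractionalIdeal R⁰ F) * (I : FractionalIdeal R⁰ F)⁻¹ = 1 := by
  have h0 : (I : FractionalIdeal R⁰ F) ≠ 0 := FractionalIdeal.coeIdeal_ne_zero.2 hb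
  rw [← FractionalIdeal.coeToSubmodule_inj, FractionalIdeal.coe_mul,
    FractionalIdeal.coe_inv_of_ne_zero _ h0, FractionalIdeal.coe_one,
    IsLocalization.coeSubmodule_top]
  rfl

open scoped nonZeroDivisors in
lemma seven_iff_six : IsDedekindDomain R ↔ ∀ I : Ideal R, I ≠ ⊥ → IsInvertibleIdeal R I := by
  constructor
  · intro h I hb
    rw [inv_iff hb]
    exact mul_inv_cancel₀ (FractionalIdeal.coeIdeal_ne_zero.2 hb)
  · intro h
    rw [isDedekindDomain_iff_mul_inv_cancel (A := R) (K := FractionRing R)]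
    intro I hI
    obtain ⟨a, J, ha, hJ⟩ := FractionalIdeal.exists_eq_spanSingleton_mul I
    have hJb : J ≠ ⊥ := by
      rintro rfl
      apply hI
      simp [hJ]
    have hJ1 := (inv_iff hJb).1 (h J hJb)
    rw [FractionalIdeal.mul_inv_cancel_iff]
    refine ⟨FractionalIdeal.spanSingleton R⁰ (algebraMap R F a) *
      (J : FractionalIdeal R⁰ F)⁻¹, ?_⟩
    have ha' : algebraMap R F a ≠ 0 := by simpa using ha
    rw [hJ, mul_mul_mul_comm, hJ1, mul_one, FractionalIdeal.spanSingleton_mul_spanSingleton,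
      inv_mul_cancel₀ ha', FractionalIdeal.spanSingleton_one]

end Helpers

/-- For an integral domain `R` the following are equivalent:
(1) `R` has no nonzero proper strong ideals;
(2) `R` has no nonzero strong prime ideals;
(3) `R` has no strongly divisorial prime ideals and each (nonzero) maximal ideal is
invertible;
(4) `R` has no strongly divisorial prime ideals and each (nonzero) maximal ideal is
divisorial;
(5) `R` is completely integrally closed and each (nonzero) maximal ideal is divisorial;
(6) `R` is a Dedekind domain;
(7) each nonzero ideal of `R` is invertible. -/
theorem tfae_dedekind {R : Type*} [CommRing R] [IsDomain R] :
    List.TFAE [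
      ¬ ∃ I : Ideal R, I ≠ ⊥ ∧ I ≠ ⊤ ∧ IsStrong R I,
      ¬ ∃ P : Ideal R, P.IsPrime ∧ P ≠ ⊥ ∧ IsStrong R P,
      (¬ ∃ P : Ideal R, P.IsPrime ∧ P ≠ ⊥ ∧ IsStrong R P ∧ IsDivisorial R P) ∧
        ∀ M : Ideal R, M.IsMaximal → M ≠ ⊥ → IsInvertibleIdeal R M,
      (¬ ∃ P : Ideal R, P.IsPrime ∧ P ≠ ⊥ ∧ IsStrong R P ∧ IsDivisorial R P) ∧
        ∀ M : Ideal R, M.IsMaximal → M ≠ ⊥ → IsDivisorial R M,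
      CompletelyIntegrallyClosed R ∧
        ∀ M : Ideal R, M.IsMaximal → M ≠ ⊥ → IsDivisorial R M,
      IsDedekindDomain R,
      ∀ I : Ideal R, I ≠ ⊥ → IsInvertibleIdeal R I] := by
  tfae_have 1 → 2 := by
    rintro h ⟨P, hP, hb, hs⟩
    exact h ⟨P, hb, hP.ne_top, hs⟩
  tfae_have 2 → 3 := by
    intro h
    refine ⟨fun ⟨P, hP, hb, hs, _⟩ => h ⟨P, hP, hb, hs⟩, fun M hM hb => ?_⟩
    exact inv_of_not_strong hM fun hs => h ⟨M, hM.isPrime, hb, hs⟩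
  tfae_have 3 → 4 := fun h => ⟨h.1, fun M hM hb => inv_divisorial (h.2 M hM hb)⟩
  tfae_have 4 → 3 := fun h => ⟨h.1, fun M hM hb =>
    inv_of_not_strong hM fun hs => h.1 ⟨M, hM.isPrime, hb, hs, h.2 M hM hb⟩⟩
  tfae_have 3 → 7 := fun h => three_to_seven h.1 h.2
  tfae_have 7 → 1 := by
    rintro h ⟨I, hb, ht, hs⟩
    exact not_inv_strong ht hs (h I hb)
  tfae_have 7 → 5 := fun h => ⟨seven_to_cic h, fun M _ hb => inv_divisorial (h M hb)⟩
  tfae_have 5 → 4 := fun h => ⟨cic_no_strong h.1, h.2⟩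
  tfae_have 6 ↔ 7 := seven_iff_six
  tfae_finish
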